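/- Let G = A × B be the direct product of non-identity groups A and B, and let φ be an injective endomorphism of G with Aφ ⊆ A, Bφ ⊆ B, and Bφ ≠ B. Fix b ∈ B \ Bφ. In the descending HNN-extension G(φ), let C be the subgroup generated by A and t, and let D be the subgroup generated by A and tb. Then C ∩ D = U, where U = ⋃_{k≥0} tᵏAt⁻ᵏ. -/

import Mathlib

/-- A group has the Howson property if the intersection of any two finitely
generated subgroups is finitely generated. -/
def HowsonGroup (G : Type*) [Group G] : Prop :=
  ∀ H K : Subgroup G, H.FG → K.FG → (H ⊓ K).FG

/-- The descending HNN-extension `G(φ) = ⟨G, t ; t⁻¹ g t = gφ (g ∈ G)⟩` of a group `G`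
with respect to an injective endomorphism `φ`, realized as the Mathlib `HNNExtension`
with base `G`, associated subgroups `φ.range` and `G` (i.e. `⊤`), so that the relation
`t⁻¹ * of g * t = of (φ g)` holds for all `g : G`. -/
abbrev DescHNN {G : Type*} [Group G] (φ : G →* G) (hφ : Function.Injective φ) : Type _ :=
  HNNExtension G (MonoidHom.range φ) ⊤
    ((MonoidHom.ofInjective hφ).symm.trans Subgroup.topEquiv.symm)

open HNNExtension

namespace DescHNN

section General

variable {G : Type*} [Group G] {φ : G →* G} {hφ : Function.Injective φ}

theorem of_mul_t (g : G) : (of g * t : DescHNN φ hφ) = t * of (φ g) := by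
  have h := HNNExtension.t_mul_of (φ := (MonoidHom.ofInjective hφ).symm.trans
    Subgroup.topEquiv.symm) (MonoidHom.ofInjective hφ g)
  simpa [MonoidHom.ofInjective_apply] using h.symm

theorem of_mul_t_pow (g : G) (k : ℕ) :
    (of g * t ^ k : DescHNN φ hφ) = t ^ k * of (φ^[k] g) := by
  induction k with
  | zero => simp
  | succ k ih =>
    rw [pow_succ, ← mul_assoc, ih, mul_assoc, of_mul_t, Function.iterate_succ_apply']
    simp only [mul_assoc]

variable (φ hφ) in
/-- The exponent sum of the stable letter. -/
noncomputable def exponent : DescHNN φ hφ →* Multiplicative ℤ :=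
  HNNExtension.lift 1 (Multiplicative.ofAdd 1) (by simp)

theorem exponent_t : exponent φ hφ t = Multiplicative.ofAdd 1 := by
  simp [exponent]

theorem exponent_of (g : G) : exponent φ hφ (of g) = 1 := by
  simp [exponent]

variable (φ hφ) in
/-- The ascending union of the conjugates `tᵏ H t⁻ᵏ`. -/
noncomputable def conjUnion (H : Subgroup G) : Subgroup (DescHNN φ hφ) :=
  ⨆ k : ℕ, (H.map of).map (MulAut.conj (t ^ k)).toMonoidHom

theorem mem_conjUnion {H : Subgroup G} (hH : H.map φ ≤ H) {x : DescHNN φ hφ} :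
    x ∈ conjUnion φ hφ H ↔ ∃ k : ℕ, ∃ g ∈ H, t ^ k * of g * (t ^ k)⁻¹ = x := by
  have hmono : Monotone fun k : ℕ =>
      (H.map (of : G →* DescHNN φ hφ)).map (MulAut.conj (t ^ k)).toMonoidHom := by
    refine monotone_nat_of_le_succ fun k => ?_
    rintro _ ⟨_, ⟨g, hg, rfl⟩, rfl⟩
    refine ⟨_, ⟨φ g, hH ⟨g, hg, rfl⟩, rfl⟩, ?_⟩
    simp only [MulEquiv.toMonoidHom_eq_coe, MonoidHom.coe_coe, MulAut.conj_apply]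
    rw [pow_succ, mul_assoc (t ^ k) t, ← of_mul_t]
    group
  rw [conjUnion, Subgroup.mem_iSup_of_directed hmono.directed_le]
  simp only [Subgroup.mem_map, MulEquiv.toMonoidHom_eq_coe, MonoidHom.coe_coe, MulAut.conj_apply,
    exists_exists_and_eq_and]

theorem t_mem_normalizer_conjUnion {H : Subgroup G} (hH : H.map φ ≤ H) :
    t ∈ Subgroup.normalizer (conjUnion φ hφ H : Set (DescHNN φ hφ)) := by
  rw [Subgroup.mem_normalizer_iff]
  refine fun x => ⟨fun hx => ?_, fun hx => ?_⟩
  · obtain ⟨k, g, hg, rfl⟩ := (mem_conjUnion hH).1 hx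
    refine (mem_conjUnion hH).2 ⟨k + 1, g, hg, ?_⟩
    rw [pow_succ']
    group
  · obtain ⟨k, g, hg, h⟩ := (mem_conjUnion hH).1 hx
    refine (mem_conjUnion hH).2 ⟨k, φ g, hH ⟨g, hg, rfl⟩, ?_⟩
    have hx' : x = t⁻¹ * (t ^ k * of g * (t ^ k)⁻¹) * t := by rw [h]; group
    have hφg : (of (φ g) : DescHNN φ hφ) = t⁻¹ * of g * t := by
      rw [mul_assoc, of_mul_t]; group
    rw [hx', hφg]
    group

theorem exponent_of_mem_conjUnion {H : Subgroup G} (hH : H.map φ ≤ H) {x : DescHNN φ hφ}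
    (hx : x ∈ conjUnion φ hφ H) : exponent φ hφ x = 1 := by
  obtain ⟨k, g, -, rfl⟩ := (mem_conjUnion hH).1 hx
  simp [exponent_of]

theorem exists_mul_zpow_eq_of_mem_sup_zpowers {H : Subgroup G} {s : DescHNN φ hφ}
    (hs : s ∈ Subgroup.normalizer (conjUnion φ hφ H : Set (DescHNN φ hφ))) {x : DescHNN φ hφ}
    (hx : x ∈ H.map of ⊔ Subgroup.zpowers s) :
    ∃ u ∈ conjUnion φ hφ H, ∃ n : ℤ, u * s ^ n = x := by
  have hle : H.map of ≤ conjUnion φ hφ H := by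
    refine le_trans ?_ (le_iSup _ 0)
    rintro _ ⟨g, hg, rfl⟩
    exact ⟨_, ⟨g, hg, rfl⟩, by simp⟩
  have hx' : x ∈ (↑(conjUnion φ hφ H ⊔ Subgroup.zpowers s) : Set (DescHNN φ hφ)) :=
    sup_le_sup_right hle _ hx
  rw [Subgroup.coe_mul_of_right_le_normalizer_left _ _ (by simpa using hs)] at hx'
  obtain ⟨u, hu, _, ⟨n, rfl⟩, rfl⟩ := hx'
  exact ⟨u, hu, n, rfl⟩

theorem conjUnion_le_map_of_sup_zpowers {H : Subgroup G} (hH : H.map φ ≤ H) (c : G)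
    (hc : ∀ x ∈ conjUnion φ hφ H, Commute (of c) x) :
    conjUnion φ hφ H ≤ H.map of ⊔ Subgroup.zpowers (t * of c) := by
  have hs : ∀ k : ℕ, ∀ g ∈ H,
      t ^ k * of g * (t ^ k)⁻¹ ∈ H.map of ⊔ Subgroup.zpowers (t * of c : DescHNN φ hφ) := by
    intro k g hg
    induction k with
    | zero => exact Subgroup.mem_sup_left ⟨g, hg, by simp⟩
    | succ k ih =>
      have hcomm := hc _ ((mem_conjUnion hH).2 ⟨k, g, hg, rfl⟩)
      have hmem : t * of c ∈ H.map of ⊔ Subgroup.zpowers (t * of c : DescHNN φ hφ) :=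
        Subgroup.mem_sup_right (Subgroup.mem_zpowers _)
      have key : t ^ (k + 1) * of g * (t ^ (k + 1))⁻¹ =
          (t * of c) * (t ^ k * of g * (t ^ k)⁻¹) * (t * of c : DescHNN φ hφ)⁻¹ := by
        rw [mul_assoc t (of c), hcomm.eq, pow_succ']
        group
      rw [key]
      exact mul_mem (mul_mem hmem ih) (inv_mem hmem)
  intro x hx
  obtain ⟨k, g, hg, rfl⟩ := (mem_conjUnion hH).1 hx
  exact hs k g hg

end General

section Prod

variable {A B : Type*} [Group A] [Group B] {φ : A × B →* A × B} {hφ : Function.Injective φ}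

theorem pow_inr_mem (hBφ : ((MonoidHom.inr A B).range).map φ ≤ (MonoidHom.inr A B).range)
    (k : ℕ) (b : B) : ∃ c : B, φ^[k] (1, b) = (1, c) := by
  induction k with
  | zero => exact ⟨b, rfl⟩
  | succ k ih =>
    obtain ⟨c, hc⟩ := ih
    obtain ⟨d, hd⟩ := hBφ ⟨(1, c), ⟨c, rfl⟩, rfl⟩
    refine ⟨d, ?_⟩
    rw [Function.iterate_succ_apply', hc]
    exact hd.symm

theorem commute_of_inr_conjUnion
    (hAφ : ((MonoidHom.inl A B).range).map φ ≤ (MonoidHom.inl A B).range)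
    (hBφ : ((MonoidHom.inr A B).range).map φ ≤ (MonoidHom.inr A B).range)
    (b : B) {x : DescHNN φ hφ} (hx : x ∈ conjUnion φ hφ (MonoidHom.inl A B).range) :
    Commute (of ((1, b) : A × B)) x := by
  obtain ⟨k, _, ⟨a, rfl⟩, rfl⟩ := (mem_conjUnion hAφ).1 hx
  obtain ⟨c, hc⟩ := pow_inr_mem hBφ k b
  have h₁ := of_mul_t_pow (hφ := hφ) ((1, b) : A × B) k
  have h₂ : Commute (of ((1, c) : A × B)) (of (MonoidHom.inl A B a) : DescHNN φ hφ) := by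
    rw [Commute, SemiconjBy, ← map_mul, ← map_mul]
    simp
  have h₃ : (of ((1, b) : A × B) : DescHNN φ hφ) = t ^ k * of ((1, c) : A × B) * (t ^ k)⁻¹ := by
    rw [eq_mul_inv_iff_mul_eq, h₁, hc]
  rw [h₃]
  exact h₂.map (MulAut.conj (t ^ k : DescHNN φ hφ))

theorem eq_one_of_inr_mem_conjUnion
    (hAφ : ((MonoidHom.inl A B).range).map φ ≤ (MonoidHom.inl A B).range)
    (hBφ : ((MonoidHom.inr A B).range).map φ ≤ (MonoidHom.inr A B).range)
    {b : B} (hb : (of ((1, b) : A × B) : DescHNN φ hφ) ∈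
      conjUnion φ hφ (MonoidHom.inl A B).range) : b = 1 := by
  obtain ⟨k, _, ⟨a, rfl⟩, h⟩ := (mem_conjUnion hAφ).1 hb
  obtain ⟨c, hc⟩ := pow_inr_mem hBφ k b
  rw [mul_inv_eq_iff_eq_mul, of_mul_t_pow, mul_right_inj] at h
  have h' := of_injective _ h
  rw [hc] at h'
  obtain rfl : c = 1 := (congrArg Prod.snd h').symm
  exact congrArg Prod.snd (hφ.iterate k (hc.trans (iterate_map_one φ k).symm))

theorem exists_t_mul_pow_eq
    (hBφ : ((MonoidHom.inr A B).range).map φ ≤ (MonoidHom.inr A B).range)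
    {b : B} (hb : ((1, b) : A × B) ∉ ((MonoidHom.inr A B).range).map φ) (n : ℕ) :
    ∃ c : B, ((t * of ((1, b) : A × B)) ^ n : DescHNN φ hφ) = t ^ n * of ((1, c) : A × B) ∧
      (c = 1 → n = 0) := by
  induction n with
  | zero => exact ⟨1, by simp [← Prod.one_eq_mk], fun _ => rfl⟩
  | succ n ih =>
    obtain ⟨c, hc, -⟩ := ih
    obtain ⟨d, hd⟩ := hBφ ⟨(1, c), ⟨c, rfl⟩, rfl⟩
    change (1, d) = φ (1, c) at hd
    refine ⟨d * b, ?_, fun h => (hb ?_).elim⟩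
    · have hdb : ((1, d * b) : A × B) = φ (1, c) * (1, b) := by rw [← hd]; simp
      rw [pow_succ, hc, hdb, map_mul, pow_succ, mul_assoc, ← mul_assoc (of _) t, of_mul_t]
      simp only [mul_assoc]
    · refine ⟨(1, c⁻¹), ⟨c⁻¹, rfl⟩, ?_⟩
      have hinv : ((1, c⁻¹) : A × B) = (1, c)⁻¹ := by simp
      rw [hinv, map_inv, ← hd]
      simp [eq_inv_of_mul_eq_one_right h]

end Prod

end DescHNN

/-- Let `G = A × B` be the direct product of non-identity groups `A` and `B`, and let `φ`
be an injective endomorphism of `G` with `Aφ ⊆ A`, `Bφ ⊆ B` and `Bφ ≠ B`. Fix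
`b ∈ B \ Bφ`. In `G(φ)`, let `C` be the subgroup generated by `A` and `t`, and `D` the
subgroup generated by `A` and `tb`. Then `C ∩ D = U = ⋃_{k ≥ 0} tᵏAt⁻ᵏ`. -/
theorem subgroup_C_inter_D_eq_U {A B : Type*} [Group A] [Group B]
    [Nontrivial A] [Nontrivial B]
    (φ : A × B →* A × B) (hφ : Function.Injective φ)
    (hAφ : ((MonoidHom.inl A B).range).map φ ≤ (MonoidHom.inl A B).range)
    (hBφ : ((MonoidHom.inr A B).range).map φ ≤ (MonoidHom.inr A B).range)
    (hBne : ((MonoidHom.inr A B).range).map φ ≠ (MonoidHom.inr A B).range)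
    (b : B) (hb : ((1, b) : A × B) ∉ ((MonoidHom.inr A B).range).map φ) :
    (((MonoidHom.inl A B).range).map (HNNExtension.of : A × B →* DescHNN φ hφ)
        ⊔ Subgroup.zpowers HNNExtension.t)
      ⊓ (((MonoidHom.inl A B).range).map (HNNExtension.of : A × B →* DescHNN φ hφ)
        ⊔ Subgroup.zpowers (HNNExtension.t * HNNExtension.of ((1, b) : A × B)))
      = ⨆ k : ℕ,
        (((MonoidHom.inl A B).range).map (HNNExtension.of : A × B →* DescHNN φ hφ)).map
          (MulAut.conj (HNNExtension.t ^ k)).toMonoidHom := by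
  set U := DescHNN.conjUnion φ hφ (MonoidHom.inl A B).range
  change _ = U
  have ht : t ∈ Subgroup.normalizer (U : Set (DescHNN φ hφ)) :=
    DescHNN.t_mem_normalizer_conjUnion hAφ
  have hcomm : ∀ x ∈ U, Commute (of ((1, b) : A × B)) x :=
    fun x hx => DescHNN.commute_of_inr_conjUnion hAφ hBφ b hx
  have hbU : of ((1, b) : A × B) ∈ Subgroup.normalizer (U : Set (DescHNN φ hφ)) :=
    Subgroup.centralizer_le_normalizer _ (Subgroup.mem_centralizer_iff.2
      fun x hx => (hcomm x hx).symm.eq)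
  have hpow : ∀ n : ℕ, (t ^ n)⁻¹ * (t * of ((1, b) : A × B)) ^ n ∈ U → n = 0 := by
    intro n hn
    obtain ⟨c, hc, hc'⟩ := DescHNN.exists_t_mul_pow_eq (hφ := hφ) hBφ hb n
    rw [hc, inv_mul_cancel_left] at hn
    exact hc' (DescHNN.eq_one_of_inr_mem_conjUnion hAφ hBφ hn)
  apply le_antisymm
  · rintro x ⟨hC, hD⟩
    obtain ⟨u, hu, n, rfl⟩ := DescHNN.exists_mul_zpow_eq_of_mem_sup_zpowers ht hC
    obtain ⟨v, hv, m, h⟩ := DescHNN.exists_mul_zpow_eq_of_mem_sup_zpowers (mul_mem ht hbU) hD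
    have hmn : m = n := by
      have := congrArg (DescHNN.exponent φ hφ) h
      simpa [DescHNN.exponent_of_mem_conjUnion hAφ hu, DescHNN.exponent_of_mem_conjUnion hAφ hv,
        DescHNN.exponent_t, DescHNN.exponent_of, ← ofAdd_zsmul] using this
    subst hmn
    have hmem : t ^ m * ((t * of ((1, b) : A × B)) ^ m)⁻¹ ∈ U := by
      have : t ^ m * ((t * of ((1, b) : A × B)) ^ m)⁻¹ = u⁻¹ * v := by
        rw [mul_inv_eq_iff_eq_mul, mul_assoc, h, inv_mul_cancel_left]
      rw [this]
      exact mul_mem (inv_mem hu) hv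
    have hm : m = 0 := by
      obtain ⟨n, rfl | rfl⟩ := m.eq_nat_or_neg
      · have h' := (Subgroup.mem_normalizer_iff.1 (inv_mem (pow_mem ht n)) _).1 hmem
        have h'' := inv_mem h'
        simp only [zpow_natCast] at h''
        simpa using hpow n (by simpa [mul_assoc] using h'')
      · simpa using hpow n (by simpa using hmem)
    simpa [hm] using hu
  · refine le_inf ?_ (DescHNN.conjUnion_le_map_of_sup_zpowers hAφ _ hcomm)
    simpa only [map_one, mul_one] using
      DescHNN.conjUnion_le_map_of_sup_zpowers (hφ := hφ) hAφ 1 (by simp)
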